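/- Let S be a numerical semigroup with Frobenius number f, multiplicity e = a_1, and Ap(S) = {w_0 < w_1 < ⋯ < w_{e−1}}. The following are equivalent: (1) S is M-pure and symmetric; (2) maxAp_M(S) = {f + a_1}; (3) maxAp_M(S) has exactly one element; (4) w_i + w_j = w_{e−1} and ord(w_i) + ord(w_j) = ord(w_{e−1}) whenever i + j = e − 1; (5) w_i ⪯_M w_{e−1} for all 0 ≤ i ≤ e − 1. -/

import Mathlib

namespace GotoNS

/-- `S` is a numerical semigroup: an additive submonoid of `ℕ` with finite
complement, different from `ℕ` itself. -/
def IsNumericalSemigroup (S : Set ℕ) : Prop :=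
  (0 : ℕ) ∈ S ∧ (∀ a b, a ∈ S → b ∈ S → a + b ∈ S) ∧ Sᶜ.Finite ∧ S ≠ Set.univ

/-- The multiplicity `e` of `S`: its smallest nonzero element. -/
noncomputable def mult (S : Set ℕ) : ℕ := sInf {n | n ∈ S ∧ n ≠ 0}

/-- The Frobenius number `f` of `S`: the largest integer not in `S`. -/
noncomputable def frob (S : Set ℕ) : ℕ := sSup {n | n ∉ S}

/-- The `k`-fold sumset `kM` of `M = S \ {0}` (with `0M = {0}`). -/
def kfold (S : Set ℕ) (k : ℕ) : Set ℕ :=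
  {s | ∃ c : Fin k → ℕ, (∀ i, c i ∈ S ∧ c i ≠ 0) ∧ ∑ i, c i = s}

/-- The order of `s`: the largest `k` such that `s` is a sum of `k` nonzero
elements of `S` (`ord 0 = 0`; junk value `0` off `S`). -/
noncomputable def ordS (S : Set ℕ) (s : ℕ) : ℕ := sSup {k | s ∈ kfold S k}

/-- The Apéry set `Ap(S; n) = {w ∈ S | w - n ∉ S}`. -/
def apery (S : Set ℕ) (n : ℕ) : Set ℕ := {w | w ∈ S ∧ ∀ s ∈ S, s + n ≠ w}

/-- `σ(α) = max {ord w | w ∈ Ap(S; α)}`. -/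
noncomputable def sigmaS (S : Set ℕ) (α : ℕ) : ℕ := sSup (ordS S '' apery S α)

/-- `𝒜(u) = {α ∈ {1, …, e} | u - α ∈ S}`. -/
def Aset (S : Set ℕ) (u : ℕ) : Set ℕ :=
  {α | 1 ≤ α ∧ α ≤ mult S ∧ ∃ s ∈ S, s + α = u}

/-- The Goto number `g(u) = min {σ(α) | α ∈ 𝒜(u)}`. -/
noncomputable def goto (S : Set ℕ) (u : ℕ) : ℕ := sInf (sigmaS S '' Aset S u)

/-- `τ`: the minimal Goto number of a nonzero element of `S`. -/
noncomputable def tau (S : Set ℕ) : ℕ := sInf (goto S '' {u | u ∈ S ∧ u ≠ 0})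

/-- `ρ`: the maximal Goto number of a nonzero element of `S`. -/
noncomputable def rho (S : Set ℕ) : ℕ := sSup (goto S '' {u | u ∈ S ∧ u ≠ 0})

/-- An integer belongs to `S` (viewed inside `ℤ`). -/
def memZ (S : Set ℕ) (z : ℤ) : Prop := ∃ n : ℕ, n ∈ S ∧ (n : ℤ) = z

/-- `T = {z ∈ ℤ \ S | z + u ∈ S for all 0 ≠ u ∈ S}`. -/
def Tset (S : Set ℕ) : Set ℤ :=
  {z | ¬ memZ S z ∧ ∀ u : ℕ, u ∈ S → u ≠ 0 → memZ S (z + (u : ℤ))}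

open Classical in
/-- The order of an integer, with the convention `ord z = -1` if `z ∉ S`. -/
noncomputable def ordZ (S : Set ℕ) (z : ℤ) : ℤ :=
  if 0 ≤ z ∧ z.toNat ∈ S then (ordS S z.toNat : ℤ) else -1

/-- `S` is symmetric: for integers `x + y = f`, exactly one of `x, y` lies in `S`. -/
def IsSymmetricNS (S : Set ℕ) : Prop :=
  ∀ x y : ℤ, x + y = (frob S : ℤ) → (memZ S x ↔ ¬ memZ S y)

/-- `u ⪯ u'` iff `u' - u ∈ S`. -/
def preceq (S : Set ℕ) (u u' : ℕ) : Prop := ∃ s ∈ S, u + s = u'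

/-- `u ⪯_M u'` iff `u + s = u'` and `ord u + ord s = ord u'` for some `s ∈ S`. -/
def preceqM (S : Set ℕ) (u u' : ℕ) : Prop :=
  ∃ s ∈ S, u + s = u' ∧ ordS S u + ordS S s = ordS S u'

/-- `Ap(S) \ {0}`. -/
def apNZ (S : Set ℕ) : Set ℕ := apery S (mult S) \ {0}

/-- Minimal elements of `Ap(S) \ {0}` with respect to `⪯`. -/
def minAp (S : Set ℕ) : Set ℕ := {w | w ∈ apNZ S ∧ ∀ w' ∈ apNZ S, preceq S w' w → w' = w}

/-- Maximal elements of `Ap(S) \ {0}` with respect to `⪯`. -/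
def maxAp (S : Set ℕ) : Set ℕ := {w | w ∈ apNZ S ∧ ∀ w' ∈ apNZ S, preceq S w w' → w' = w}

/-- Minimal elements of `Ap(S) \ {0}` with respect to `⪯_M`. -/
def minApM (S : Set ℕ) : Set ℕ := {w | w ∈ apNZ S ∧ ∀ w' ∈ apNZ S, preceqM S w' w → w' = w}

/-- Maximal elements of `Ap(S) \ {0}` with respect to `⪯_M`. -/
def maxApM (S : Set ℕ) : Set ℕ := {w | w ∈ apNZ S ∧ ∀ w' ∈ apNZ S, preceqM S w w' → w' = w}

/-- `S` is pure if all elements of `maxAp S` have the same order. -/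
def IsPure (S : Set ℕ) : Prop := ∀ w ∈ maxAp S, ∀ w' ∈ maxAp S, ordS S w = ordS S w'

/-- `S` is `M`-pure if all elements of `maxApM S` have the same order. -/
def IsMPure (S : Set ℕ) : Prop := ∀ w ∈ maxApM S, ∀ w' ∈ maxApM S, ordS S w = ordS S w'

/-- `S` is `M`-additive if `ord (u + a₁) = ord u + 1` for all `u ∈ S`. -/
def IsMAdditive (S : Set ℕ) : Prop := ∀ u ∈ S, ordS S (u + mult S) = ordS S u + 1

/-- The reduction number `r = min {k | (k+1)M = a₁ + kM}`. -/
noncomputable def redNum (S : Set ℕ) : ℕ :=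
  sInf {k | kfold S (k + 1) = (fun x => mult S + x) '' kfold S k}

/-- The set of minimal generators of `S`: nonzero elements of `S` that are not
sums of two nonzero elements of `S`. -/
def minGens (S : Set ℕ) : Set ℕ :=
  {a | a ∈ S ∧ a ≠ 0 ∧ ∀ x ∈ S, ∀ y ∈ S, x ≠ 0 → y ≠ 0 → x + y ≠ a}

/-- `δ_w = max {ord w + ord w' | w' ∈ S, w + w' ∈ Ap(S)}`. -/
noncomputable def deltaI (S : Set ℕ) (w : ℕ) : ℕ :=
  sSup ((fun w' => ordS S w + ordS S w') '' {w' | w' ∈ S ∧ w + w' ∈ apery S (mult S)})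

/-- `δ = min {δ_w | w ∈ Ap(S)}`. -/
noncomputable def deltaNS (S : Set ℕ) : ℕ := sInf (deltaI S '' apery S (mult S))

/-- `γ_w = max {ord w + ⌊w'/a₁⌋ | w' ∈ S, w + w' ∈ Ap(S)}`. -/
noncomputable def gammaI (S : Set ℕ) (w : ℕ) : ℕ :=
  sSup ((fun w' => ordS S w + w' / mult S) '' {w' | w' ∈ S ∧ w + w' ∈ apery S (mult S)})

/-- `γ = min {γ_w | w ∈ Ap(S)}`. -/
noncomputable def gammaNS (S : Set ℕ) : ℕ := sInf (gammaI S '' apery S (mult S))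

/-- `ord(C) = min {ord (f+1), …, ord (f+a₁)}`. -/
noncomputable def ordC (S : Set ℕ) : ℕ :=
  sInf ((fun α => ordS S (frob S + α)) '' Set.Icc 1 (mult S))


lemma le_of_mem_kfold {S : Set ℕ} {s k : ℕ} (h : s ∈ kfold S k) : k ≤ s := by
  obtain ⟨c, hc, rfl⟩ := h
  calc k = ∑ _i : Fin k, 1 := by simp
    _ ≤ ∑ i, c i := Finset.sum_le_sum fun i _ => Nat.one_le_iff_ne_zero.2 (hc i).2

lemma bddAbove_kfold (S : Set ℕ) (s : ℕ) : BddAbove {k | s ∈ kfold S k} :=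
  ⟨s, fun _ => le_of_mem_kfold⟩

lemma ordS_zero (S : Set ℕ) : ordS S 0 = 0 :=
  Nat.le_zero.1 (csSup_le' fun _ => le_of_mem_kfold)

lemma mem_kfold_one {S : Set ℕ} {s : ℕ} (hs : s ∈ S) (h0 : s ≠ 0) : s ∈ kfold S 1 :=
  ⟨fun _ => s, fun _ => ⟨hs, h0⟩, by simp⟩

lemma ordS_pos {S : Set ℕ} {s : ℕ} (hs : s ∈ S) (h0 : s ≠ 0) : 1 ≤ ordS S s :=
  le_csSup (bddAbove_kfold S s) (mem_kfold_one hs h0)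

lemma mem_kfold_ordS {S : Set ℕ} {s : ℕ} (hs : s ∈ S) : s ∈ kfold S (ordS S s) := by
  have hne : {k | s ∈ kfold S k}.Nonempty := by
    rcases eq_or_ne s 0 with rfl | h0
    · exact ⟨0, Fin.elim0, fun i => i.elim0, by simp⟩
    · exact ⟨1, mem_kfold_one hs h0⟩
  exact Nat.sSup_mem hne (bddAbove_kfold S s)

lemma add_mem_kfold {S : Set ℕ} {s t k l : ℕ} (hs : s ∈ kfold S k) (ht : t ∈ kfold S l) :
    s + t ∈ kfold S (k + l) := by
  obtain ⟨c, hc, rfl⟩ := hs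
  obtain ⟨d, hd, rfl⟩ := ht
  refine ⟨Fin.append c d, fun i => ?_, by simp [Fin.sum_univ_add]⟩
  refine Fin.addCases (fun i => ?_) (fun i => ?_) i
  · simpa using hc i
  · simpa using hd i

lemma ordS_add_le {S : Set ℕ} {s t : ℕ} (hs : s ∈ S) (ht : t ∈ S) :
    ordS S s + ordS S t ≤ ordS S (s + t) :=
  le_csSup (bddAbove_kfold S _) (add_mem_kfold (mem_kfold_ordS hs) (mem_kfold_ordS ht))

namespace preceqM

variable {S : Set ℕ} {u v x : ℕ}

lemma le (h : preceqM S u v) : u ≤ v := by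
  obtain ⟨s, -, h, -⟩ := h
  omega

lemma trans (hS : IsNumericalSemigroup S) (hu : u ∈ S) (huv : preceqM S u v)
    (hvx : preceqM S v x) : preceqM S u x := by
  obtain ⟨s, hs, rfl, hso⟩ := huv
  obtain ⟨t, ht, rfl, hto⟩ := hvx
  have h1 := ordS_add_le hs ht
  have h2 := ordS_add_le hu (hS.2.1 s t hs ht)
  rw [← add_assoc] at h2
  exact ⟨s + t, hS.2.1 s t hs ht, by ring, by omega⟩

lemma refl (hS : IsNumericalSemigroup S) : preceqM S u u :=
  ⟨0, hS.1, by simp, by simp [ordS_zero]⟩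

lemma zero (hv : v ∈ S) : preceqM S 0 v :=
  ⟨v, hv, by simp, by simp [ordS_zero]⟩

end preceqM

lemma IsSymmetricNS.preceq_frob_add_mult {S : Set ℕ} (hsym : IsSymmetricNS S) {u : ℕ}
    (hu : u ∈ apery S (mult S)) :
    preceq S u (frob S + mult S) := by
  have hnot : ¬ memZ S ((u : ℤ) - mult S) := by
    rintro ⟨s, hs, hse⟩
    exact hu.2 s hs (by omega)
  obtain ⟨s, hs, hse⟩ :=
    (hsym (frob S + mult S - u : ℤ) ((u : ℤ) - mult S) (by ring)).2 hnot
  exact ⟨s, hs, by omega⟩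

namespace IsNumericalSemigroup

variable {S : Set ℕ}

lemma bddAbove_gaps (hS : IsNumericalSemigroup S) : BddAbove {n | n ∉ S} :=
  Set.Finite.bddAbove hS.2.2.1

lemma frob_notMem (hS : IsNumericalSemigroup S) : frob S ∉ S :=
  Nat.sSup_mem (s := {n | n ∉ S}) ((Set.ne_univ_iff_exists_notMem S).1 hS.2.2.2) hS.bddAbove_gaps

lemma mem_of_frob_lt (hS : IsNumericalSemigroup S) {m : ℕ} (hm : frob S < m) : m ∈ S := by
  by_contra h
  exact (le_csSup hS.bddAbove_gaps h).not_gt hm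

lemma mult_mem (hS : IsNumericalSemigroup S) : mult S ∈ S ∧ mult S ≠ 0 :=
  Nat.sInf_mem (s := {n | n ∈ S ∧ n ≠ 0})
    ⟨frob S + 1, hS.mem_of_frob_lt (Nat.lt_succ_self _), Nat.succ_ne_zero _⟩

lemma frob_add_mult_mem_apery (hS : IsNumericalSemigroup S) :
    frob S + mult S ∈ apery S (mult S) := by
  have h := hS.mult_mem.2
  refine ⟨hS.mem_of_frob_lt (by omega), fun s hs hse => hS.frob_notMem ?_⟩
  rwa [← Nat.add_right_cancel hse]

lemma le_of_mem_apery (hS : IsNumericalSemigroup S) {u : ℕ} (hu : u ∈ apery S (mult S)) :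
    u ≤ frob S + mult S := by
  by_contra! h
  exact hu.2 (u - mult S) (hS.mem_of_frob_lt (by omega)) (by omega)

lemma frob_add_mult_mem_apNZ (hS : IsNumericalSemigroup S) : frob S + mult S ∈ apNZ S := by
  have h := hS.mult_mem.2
  refine ⟨hS.frob_add_mult_mem_apery, ?_⟩
  simp only [Set.mem_singleton_iff]
  omega

lemma frob_add_mult_mem_maxApM (hS : IsNumericalSemigroup S) : frob S + mult S ∈ maxApM S :=
  ⟨hS.frob_add_mult_mem_apNZ, fun _ hu h => le_antisymm (hS.le_of_mem_apery hu.1) h.le⟩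

lemma mem_apery_of_add_mem_apery (hS : IsNumericalSemigroup S) {u s : ℕ} (hu : u ∈ S)
    (hs : s ∈ S) (h : u + s ∈ apery S (mult S)) : s ∈ apery S (mult S) :=
  ⟨hs, fun t ht hts => h.2 (u + t) (hS.2.1 u t hu ht) (by omega)⟩

/-- Every nonzero element of the Apéry set lies below a maximal one. -/
lemma exists_maxApM_preceqM (hS : IsNumericalSemigroup S) {u : ℕ} (hu : u ∈ apNZ S) :
    ∃ x ∈ maxApM S, preceqM S u x := by
  induction h : frob S + mult S - u using Nat.strong_induction_on generalizing u with
  | _ d ih =>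
    by_cases hmax : u ∈ maxApM S
    · exact ⟨u, hmax, preceqM.refl hS⟩
    · have hex : ∃ v ∈ apNZ S, preceqM S u v ∧ v ≠ u := by
        by_contra! hcon
        exact hmax ⟨hu, hcon⟩
      obtain ⟨v, hv, huv, hne⟩ := hex
      have h1 := huv.le
      have h2 := hS.le_of_mem_apery hv.1
      obtain ⟨x, hx, hvx⟩ := ih _ (by omega) hv rfl
      exact ⟨x, hx, huv.trans hS hu.1.1 hvx⟩

lemma maxApM_eq_singleton_of_forall_preceqM (hS : IsNumericalSemigroup S)
    (h : ∀ u ∈ apery S (mult S), preceqM S u (frob S + mult S)) :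
    maxApM S = {frob S + mult S} := by
  ext u
  refine ⟨fun hu => (hu.2 _ hS.frob_add_mult_mem_apNZ (h u hu.1.1)).symm, ?_⟩
  rintro rfl
  exact hS.frob_add_mult_mem_maxApM

lemma forall_preceqM_of_maxApM_eq_singleton (hS : IsNumericalSemigroup S) {x : ℕ}
    (h : maxApM S = {x}) : ∀ u ∈ apery S (mult S), preceqM S u (frob S + mult S) := by
  intro u hu
  have hx := hS.frob_add_mult_mem_maxApM
  rw [h, Set.mem_singleton_iff] at hx
  rcases eq_or_ne u 0 with rfl | h0
  · exact preceqM.zero hS.frob_add_mult_mem_apery.1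
  · obtain ⟨y, hy, huy⟩ := hS.exists_maxApM_preceqM (u := u) ⟨hu, h0⟩
    rw [h, Set.mem_singleton_iff] at hy
    rwa [hx, ← hy]

lemma maxApM_eq_singleton_of_isMPure (hS : IsNumericalSemigroup S) (hpure : IsMPure S)
    (hsym : IsSymmetricNS S) : maxApM S = {frob S + mult S} := by
  ext u
  refine ⟨fun hu => ?_, ?_⟩
  · obtain ⟨s, hs, hse⟩ := hsym.preceq_frob_add_mult hu.1.1
    have hle := ordS_add_le hu.1.1.1 hs
    rw [hse, ← hpure u hu _ hS.frob_add_mult_mem_maxApM] at hle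
    have hs0 : s = 0 := by
      by_contra h0
      have := ordS_pos hs h0
      omega
    simpa [hs0] using hse
  · rintro rfl
    exact hS.frob_add_mult_mem_maxApM

lemma add_mul_mult_mem (hS : IsNumericalSemigroup S) {s : ℕ} (hs : s ∈ S) (k : ℕ) :
    s + k * mult S ∈ S := by
  induction k with
  | zero => simpa
  | succ k ih =>
    rw [Nat.succ_mul, ← add_assoc]
    exact hS.2.1 _ _ ih hS.mult_mem.1

lemma exists_memZ_add_mul_mult (hS : IsNumericalSemigroup S) (z : ℤ) :
    ∃ k : ℕ, memZ S (z + k * mult S) := by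
  have he : (1 : ℤ) ≤ mult S := by
    have := hS.mult_mem.2
    omega
  have hk : (frob S : ℤ) + 1 + |z| ≤ (frob S + 1 + z.natAbs : ℕ) * (mult S : ℤ) := by
    push_cast
    have : (0 : ℤ) ≤ frob S + 1 + |z| := by positivity
    nlinarith
  have hz := neg_abs_le z
  refine ⟨frob S + 1 + z.natAbs, (z + (frob S + 1 + z.natAbs : ℕ) * (mult S : ℤ)).toNat,
    hS.mem_of_frob_lt ?_, Int.toNat_of_nonneg ?_⟩ <;> omega

lemma isSymmetricNS_of_forall_preceq (hS : IsNumericalSemigroup S)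
    (h : ∀ u ∈ apery S (mult S), preceq S u (frob S + mult S)) : IsSymmetricNS S := by
  intro x y hxy
  constructor
  · rintro ⟨a, ha, rfl⟩ ⟨b, hb, rfl⟩
    have hab : a + b = frob S := by exact_mod_cast hxy
    exact hS.frob_notMem (hab ▸ hS.2.1 a b ha hb)
  · intro hy
    classical
    have hex := hS.exists_memZ_add_mul_mult y
    obtain ⟨u, hu, hue⟩ := Nat.find_spec hex
    have hmin := fun m => Nat.find_min hex (m := m)
    cases hk : Nat.find hex with
    | zero =>
      rw [hk] at hue
      exact absurd ⟨u, hu, by simpa using hue⟩ hy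
    | succ k =>
      rw [hk] at hue hmin
      push_cast at hue
      have huap : u ∈ apery S (mult S) := by
        refine ⟨hu, fun s hs hsu => hmin k (Nat.lt_succ_self k) ⟨s, hs, ?_⟩⟩
        have : (s : ℤ) + mult S = u := by exact_mod_cast hsu
        linarith
      obtain ⟨s, hs, hsu⟩ := h u huap
      refine ⟨s + k * mult S, hS.add_mul_mult_mem hs k, ?_⟩
      have : (u : ℤ) + s = frob S + mult S := by exact_mod_cast hsu
      push_cast
      linarith

lemma eq_last_of_range_eq_apery (hS : IsNumericalSemigroup S) {n : ℕ} {w : Fin (n + 1) → ℕ}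
    (hw : StrictMono w) (hrange : Set.range w = apery S (mult S)) :
    w (Fin.last n) = frob S + mult S := by
  refine le_antisymm (hS.le_of_mem_apery (hrange ▸ Set.mem_range_self _)) ?_
  obtain ⟨i, hi⟩ := hrange.symm ▸ hS.frob_add_mult_mem_apery
  exact hi ▸ hw.monotone (Fin.le_last i)

end IsNumericalSemigroup

/-- A strictly increasing tuple whose entries are paired up with constant sum `w i + w (σ i)` is
paired up by reversal. -/
lemma eq_rev_of_strictMono_of_add_eq {n c : ℕ} {w : Fin (n + 1) → ℕ} (hw : StrictMono w)
    {σ : Fin (n + 1) → Fin (n + 1)} (hσ : ∀ i, w i + w (σ i) = c) (i : Fin (n + 1)) :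
    σ i = i.rev := by
  have hmono : StrictMono fun i => (σ i).rev := by
    intro i j hij
    have h1 := hw hij
    have h2 := hσ i
    have h3 := hσ j
    exact Fin.rev_lt_rev.2 (hw.lt_iff_lt.1 (by omega))
  have h : (σ i).rev = i := le_antisymm hmono.apply_le hmono.le_apply
  rw [← Fin.rev_rev (σ i), h]

/-- characterizations of `M`-pure symmetry. -/
theorem statement11 (S : Set ℕ) (hS : IsNumericalSemigroup S)
    (n : ℕ) (w : Fin (n + 1) → ℕ) (hw : StrictMono w)
    (hrange : Set.range w = apery S (mult S)) (hn : n + 1 = mult S) :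
    List.TFAE [IsMPure S ∧ IsSymmetricNS S,
      maxApM S = {frob S + mult S},
      ∃ x, maxApM S = {x},
      ∀ i j : Fin (n + 1), (i : ℕ) + (j : ℕ) = n →
        w i + w j = w (Fin.last n) ∧
        ordS S (w i) + ordS S (w j) = ordS S (w (Fin.last n)),
      ∀ i : Fin (n + 1), preceqM S (w i) (w (Fin.last n))] := by
  have hlast := hS.eq_last_of_range_eq_apery hw hrange
  have hmem : ∀ i, w i ∈ apery S (mult S) := fun i => hrange ▸ Set.mem_range_self i
  have hforall : (∀ i, preceqM S (w i) (w (Fin.last n))) ↔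
      ∀ u ∈ apery S (mult S), preceqM S u (frob S + mult S) := by
    rw [← hrange, Set.forall_mem_range, hlast]
  tfae_have 1 → 2 := fun h => hS.maxApM_eq_singleton_of_isMPure h.1 h.2
  tfae_have 2 → 3 := fun h => ⟨_, h⟩
  tfae_have 3 → 5 := fun ⟨_, h⟩ => hforall.2 (hS.forall_preceqM_of_maxApM_eq_singleton h)
  tfae_have 5 → 4 := by
    intro h
    choose s hs hadd hord using h
    have hsap : ∀ i, s i ∈ Set.range w := fun i => by
      rw [hrange]
      exact hS.mem_apery_of_add_mem_apery (hmem i).1 (hs i) (hadd i ▸ hmem _)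
    choose σ hσ using hsap
    intro i j hij
    have hj : j = σ i := by
      rw [eq_rev_of_strictMono_of_add_eq hw (σ := σ) (fun k => by rw [hσ, hadd]) i, Fin.ext_iff,
        Fin.val_rev]
      omega
    rw [hj, hσ]
    exact ⟨hadd i, hord i⟩
  tfae_have 4 → 5 := by
    intro h i
    obtain ⟨h1, h2⟩ := h i i.rev (by rw [Fin.val_rev]; omega)
    exact ⟨w i.rev, (hmem _).1, h1, h2⟩
  tfae_have 5 → 1 := by
    intro h
    rw [hforall] at h
    refine ⟨?_, hS.isSymmetricNS_of_forall_preceq fun u hu => ?_⟩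
    · rw [IsMPure, hS.maxApM_eq_singleton_of_forall_preceqM h]
      rintro _ rfl _ rfl
      rfl
    · obtain ⟨s, hs, hsu, -⟩ := h u hu
      exact ⟨s, hs, hsu⟩
  tfae_finish

end GotoNS
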